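/- arXiv:2205.11855 — 11 statements merged into one kernel-verified Lean document; each statement's English description precedes it below -/
import Mathlib

section
/- Let X be a complete metric space and let S ⊆ X be a totally bounded subset. Then for every locally finite cover 𝒪 of S by open subsets of X, there exists a number α > 0 such that every subset B ⊆ S with diam(B) < α is covered by finitely many members of 𝒪. -/
open Metric Set

/-- A family `𝒪` of subsets of a metric space `X` is *locally finite* if every point of `X`
has a neighborhood meeting only finitely many members of `𝒪`. -/
def LocallyFiniteFamily {X : Type*} [MetricSpace X] (𝒪 : Set (Set X)) : Prop :=
  ∀ x : X, ∃ U ∈ nhds x, {O ∈ 𝒪 | (O ∩ U).Nonempty}.Finite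

/-- `a` is an `ε`-chain of length `n` joining `x` to `y`. -/
def IsEpsChain {X : Type*} [MetricSpace X] (ε : ℝ) (n : ℕ) (a : ℕ → X) (x y : X) : Prop :=
  a 0 = x ∧ a n = y ∧ ∀ i < n, dist (a i) (a (i + 1)) ≤ ε

/-- A metric space is *chainable* if every pair of points can be joined by an `ε`-chain,
for every `ε > 0`. -/
def Chainable (X : Type*) [MetricSpace X] : Prop :=
  ∀ ε > (0 : ℝ), ∀ x y : X, ∃ n a, IsEpsChain ε n a x y

/-- A metric space is *uniformly chainable* if for each `ε > 0` there is an `n` such that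
every pair of points can be joined by an `ε`-chain of length `n`. -/
def UniformlyChainable (X : Type*) [MetricSpace X] : Prop :=
  ∀ ε > (0 : ℝ), ∃ n : ℕ, ∀ x y : X, ∃ a, IsEpsChain ε n a x y

/-- A metric space is *finitely chainable* if for each `ε > 0` there are finitely many points
`p ∈ P` and an `m ∈ ℕ` such that every point can be joined to some `p ∈ P` by an `ε`-chain
of length `m`. -/
def FinitelyChainable (X : Type*) [MetricSpace X] : Prop :=
  ∀ ε > (0 : ℝ), ∃ (P : Finset X) (m : ℕ), ∀ x : X, ∃ p ∈ P, ∃ a, IsEpsChain ε m a x p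

/-- A metric space is *uniformly locally compact* if there is an `ε > 0` such that every
closed ball of radius `ε` is compact. -/
def UniformlyLocallyCompact (X : Type*) [MetricSpace X] : Prop :=
  ∃ ε > (0 : ℝ), ∀ x : X, IsCompact (Metric.closedBall x ε)

/-- `α` is a *Lebesgue number* for the cover `𝒪` of the set `S`: `α > 0` and every subset
of `S` of diameter `< α` is contained in a single member of `𝒪`. -/
def IsLebesgueNumberFor {X : Type*} [MetricSpace X] (α : ℝ) (𝒪 : Set (Set X)) (S : Set X) :
    Prop :=
  0 < α ∧ ∀ A ⊆ S, EMetric.diam A < ENNReal.ofReal α → ∃ O ∈ 𝒪, A ⊆ O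

/-- A metric space is an *Atsuji space* if every open cover of it has a Lebesgue number. -/
def IsAtsuji (X : Type*) [MetricSpace X] : Prop :=
  ∀ 𝒪 : Set (Set X), (∀ O ∈ 𝒪, IsOpen O) → ⋃₀ 𝒪 = Set.univ →
    ∃ α, IsLebesgueNumberFor α 𝒪 Set.univ

/-- A metric space has *property P* if for every `x` and every real `r` with
`0 ≤ r < sup_{y} d(x, y)` there is a point `z` with `d(x, z) = r`.  (The supremum is taken
in `ℝ≥0∞` so that unbounded spaces are handled correctly.) -/
def PropertyP (X : Type*) [MetricSpace X] : Prop :=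
  ∀ (x : X) (r : ℝ), 0 ≤ r → ENNReal.ofReal r < ⨆ y : X, edist x y → ∃ z : X, dist x z = r

/-- A metric space is *Menger convex* if for all `x, y` and `0 ≤ r ≤ d(x, y)` the closed
balls `B[x, r]` and `B[y, d(x, y) - r]` intersect. -/
def MengerConvex (X : Type*) [MetricSpace X] : Prop :=
  ∀ x y : X, ∀ r : ℝ, 0 ≤ r → r ≤ dist x y →
    ∃ z : X, dist x z ≤ r ∧ dist y z ≤ dist x y - r

/-- A metric space is *metrically convex* if for any two distinct points `x, y` there is a
third point `z` (distinct from both) with `d(x, y) = d(x, z) + d(z, y)`. -/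
def MetricallyConvex (X : Type*) [MetricSpace X] : Prop :=
  ∀ x y : X, x ≠ y → ∃ z : X, z ≠ x ∧ z ≠ y ∧ dist x y = dist x z + dist z y

/-- Only finitely many members of a locally finite family meet a given compact set. -/
theorem LocallyFiniteFamily.finite_inter_nonempty_of_isCompact {X : Type*} [MetricSpace X]
    {𝒪 : Set (Set X)} (h𝒪 : LocallyFiniteFamily 𝒪) {K : Set X} (hK : IsCompact K) :
    {O ∈ 𝒪 | (O ∩ K).Nonempty}.Finite := by
  choose U hU hfin using h𝒪
  obtain ⟨t, -, ht⟩ := hK.elim_nhds_subcover U fun x _ => hU x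
  refine (t.finite_toSet.biUnion fun x _ => hfin x).subset ?_
  rintro O ⟨hO, y, hyO, hyK⟩
  obtain ⟨x, hx, hyx⟩ := mem_iUnion₂.1 (ht hyK)
  exact mem_iUnion₂.2 ⟨x, hx, hO, y, hyO, hyx⟩

/-- Let `X` be a complete metric space and `S ⊆ X` totally bounded. Then for
every locally finite cover `𝒪` of `S` by open subsets of `X`, there is an `α > 0` such that
every `B ⊆ S` with `diam B < α` is covered by finitely many members of `𝒪`. -/
theorem statement_0 {X : Type*} [MetricSpace X] [CompleteSpace X] (S : Set X)
    (hS : TotallyBounded S) (𝒪 : Set (Set X)) (hopen : ∀ O ∈ 𝒪, IsOpen O)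
    (hcover : S ⊆ ⋃₀ 𝒪) (hlf : LocallyFiniteFamily 𝒪) :
    ∃ α > (0 : ℝ), ∀ B ⊆ S, EMetric.diam B < ENNReal.ofReal α →
      ∃ F ⊆ 𝒪, F.Finite ∧ B ⊆ ⋃₀ F := by
  have hK : IsCompact (closure S) :=
    hS.closure.isCompact_of_isClosed isClosed_closure
  refine ⟨1, one_pos, fun B hB _ => ⟨{O ∈ 𝒪 | (O ∩ closure S).Nonempty}, sep_subset _ _,
    hlf.finite_inter_nonempty_of_isCompact hK, fun y hy => ?_⟩⟩
  obtain ⟨O, hO, hyO⟩ := hcover (hB hy)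
  exact ⟨O, ⟨hO, y, hyO, subset_closure (hB hy)⟩, hyO⟩
end

section
/- Let X be a complete, finitely chainable metric space and let S ⊆ X be a subset whose metric completion is an Atsuji space. Then for every locally finite cover 𝒪 of S by open subsets of X, there exists α > 0 such that every subset B ⊆ S with diam(B) < α is covered by finitely many members of 𝒪. -/
open Metric Set

/-- Let `X` be a complete, finitely chainable metric space and let `S ⊆ X`
be a subset whose metric completion is an Atsuji space. Then for every locally finite cover
`𝒪` of `S` by open subsets of `X`, there is an `α > 0` such that every `B ⊆ S` with
`diam B < α` is covered by finitely many members of `𝒪`. -/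
theorem statement_1 {X : Type*} [MetricSpace X] [CompleteSpace X]
    (hX : FinitelyChainable X) (S : Set X)
    (hScompl : IsAtsuji (UniformSpace.Completion S))
    (𝒪 : Set (Set X)) (hopen : ∀ O ∈ 𝒪, IsOpen O)
    (hcover : S ⊆ ⋃₀ 𝒪) (hlf : LocallyFiniteFamily 𝒪) :
    ∃ α > (0 : ℝ), ∀ B ⊆ S, EMetric.diam B < ENNReal.ofReal α →
      ∃ F ⊆ 𝒪, F.Finite ∧ B ⊆ ⋃₀ F := by
  have huc : UniformContinuous (Subtype.val : S → X) := uniformContinuous_subtype_val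
  let ι : UniformSpace.Completion S → X := UniformSpace.Completion.extension Subtype.val
  have hι : Continuous ι := UniformSpace.Completion.continuous_extension
  have hιcoe : ∀ s : S, ι (s : UniformSpace.Completion S) = s :=
    fun s ↦ UniformSpace.Completion.extension_coe huc s
  obtain ⟨α, hα, hleb⟩ := hScompl
    {V | ∃ U : Set X, IsOpen U ∧ {O ∈ 𝒪 | (O ∩ U).Nonempty}.Finite ∧ V = ι ⁻¹' U}
    (by
      rintro _ ⟨U, hU, -, rfl⟩
      exact hU.preimage hι)
    (by
      refine eq_univ_of_forall fun z ↦ ?_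
      obtain ⟨U, hU, hfin⟩ := hlf (ι z)
      refine ⟨ι ⁻¹' interior U, ⟨interior U, isOpen_interior, hfin.subset ?_, rfl⟩,
        mem_interior_iff_mem_nhds.2 hU⟩
      exact fun O hO ↦ ⟨hO.1, hO.2.mono (inter_subset_inter_right O interior_subset)⟩)
  refine ⟨α, hα, fun B hBS hB ↦ ?_⟩
  let A : Set S := Subtype.val ⁻¹' B
  have hdiam : ediam ((fun s : S ↦ (s : UniformSpace.Completion S)) '' A) ≤
      ediam B := by
    rw [UniformSpace.Completion.coe_isometry.ediam_image, ← isometry_subtype_coe.ediam_image]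
    exact ediam_mono (image_preimage_subset _ _)
  obtain ⟨_, ⟨U, -, hfin, rfl⟩, hAU⟩ := hleb _ (subset_univ _) (hdiam.trans_lt hB)
  refine ⟨_, fun O hO ↦ hO.1, hfin, fun b hb ↦ ?_⟩
  obtain ⟨O, hO, hbO⟩ := hcover (hBS hb)
  have hbU : b ∈ U := by
    have h : ι ((⟨b, hBS hb⟩ : S) : UniformSpace.Completion S) ∈ U :=
      hAU (mem_image_of_mem _ hb)
    rwa [hιcoe] at h
  exact ⟨O, ⟨hO, b, hbO, hbU⟩, hbO⟩
end

section
/- In the Banach space ℓ¹ of absolutely summable real sequences, let S = {e_m/n : m, n ∈ ℕ, m, n ≥ 1} ∪ {0}, where e_m is the sequence with m-th entry 1 and all other entries 0. Then every cover of S by open subsets of ℓ¹ has a Lebesgue number, yet S is not totally bounded. (Hence the converse of the generalized Lebesgue number lemma fails.) -/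
open Metric Set

/-- The subset `S = {e_m / n : m, n ≥ 1} ∪ {0}` of `ℓ¹`, where `e_m` is the `m`-th standard
unit vector. -/
noncomputable def atsujiSubset : Set (lp (fun _ : ℕ => ℝ) 1) :=
  {x | ∃ m n : ℕ, 1 ≤ m ∧ 1 ≤ n ∧ x = (1 / (n : ℝ)) • lp.single 1 m 1} ∪ {0}

/-- A point of `atsujiSubset` other than `e_m / n` has distance at least `1 / (n * (n + 1))`
from it. -/
theorem atsujiSubset_dist_ge {m n : ℕ} (hn : 1 ≤ n) {b : lp (fun _ : ℕ => ℝ) 1}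
    (hb : b ∈ atsujiSubset) (hne : b ≠ (1 / (n : ℝ)) • lp.single 1 m 1) :
    1 / ((n : ℝ) * (n + 1)) ≤ dist ((1 / (n : ℝ)) • lp.single 1 m (1 : ℝ)) b := by
  have hn' : (1 : ℝ) ≤ n := by exact_mod_cast hn
  have hle : 1 / ((n : ℝ) * (n + 1)) ≤ 1 / n :=
    one_div_le_one_div_of_le (by linarith) (by nlinarith)
  rw [dist_eq_norm]
  refine le_trans ?_ (lp.norm_apply_le_norm one_ne_zero _ m)
  rcases hb with ⟨k, j, -, hj, rfl⟩ | rfl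
  · have hj' : (1 : ℝ) ≤ j := by exact_mod_cast hj
    change _ ≤ ‖1 / (n : ℝ) * (lp.single (E := fun _ : ℕ => ℝ) 1 m 1) m -
      1 / (j : ℝ) * (lp.single (E := fun _ : ℕ => ℝ) 1 k 1) m‖
    by_cases hk : m = k
    · subst hk
      have hjn : j ≠ n := fun h => hne (by rw [h])
      have key : 1 / ((n : ℝ) * (n + 1)) ≤ |1 / (n : ℝ) - 1 / j| := by
        rcases lt_or_gt_of_ne hjn with h | h
        · have h' : (j : ℝ) + 1 ≤ n := by exact_mod_cast h
          rw [abs_sub_comm]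
          refine le_trans ?_ (le_abs_self _)
          rw [div_sub_div _ _ (by positivity) (by positivity),
            div_le_div_iff₀ (by positivity) (by positivity)]
          nlinarith [mul_le_mul_of_nonneg_right h' (by linarith : (0 : ℝ) ≤ n),
            mul_nonneg (mul_nonneg (by linarith : (0 : ℝ) ≤ n) (by linarith : (0 : ℝ) ≤ n + 1))
              (by linarith : (0 : ℝ) ≤ n - j - 1)]
        · have h' : (n : ℝ) + 1 ≤ j := by exact_mod_cast h
          refine le_trans ?_ (le_abs_self _)
          have h1 : 1 / (j : ℝ) ≤ 1 / (n + 1) :=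
            one_div_le_one_div_of_le (by linarith) h'
          have h2 : 1 / ((n : ℝ) * (n + 1)) = 1 / n - 1 / (n + 1) := by
            field_simp
            ring
          linarith
      simpa using key
    · simpa [hk] using hle
  · simpa using hle

theorem atsujiSubset_exists_lebesgueNumber {𝒪 : Set (Set (lp (fun _ : ℕ => ℝ) 1))}
    (hopen : ∀ O ∈ 𝒪, IsOpen O) (hcov : atsujiSubset ⊆ ⋃₀ 𝒪) :
    ∃ α, IsLebesgueNumberFor α 𝒪 atsujiSubset := by
  obtain ⟨O₀, hO₀, h0⟩ := hcov (Or.inr rfl : (0 : lp (fun _ : ℕ => ℝ) 1) ∈ atsujiSubset)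
  obtain ⟨δ, hδ, hball⟩ := Metric.isOpen_iff.1 (hopen O₀ hO₀) 0 h0
  obtain ⟨N, hN⟩ := exists_nat_one_div_lt hδ
  refine ⟨1 / (((N : ℝ) + 1) * (N + 2)), by positivity, fun A hA hdiam => ?_⟩
  by_cases hsub : A ⊆ ball 0 δ
  · exact ⟨O₀, hO₀, hsub.trans hball⟩
  obtain ⟨a, haA, ha⟩ := Set.not_subset.1 hsub
  obtain ⟨O, hO, haO⟩ := hcov (hA haA)
  refine ⟨O, hO, fun b hb => ?_⟩
  suffices h : b = a by rwa [h]
  rcases hA haA with ⟨m, n, -, hn, rfl⟩ | rfl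
  · by_contra hne
    have hn' : (1 : ℝ) ≤ n := by exact_mod_cast hn
    have hδn : δ ≤ 1 / (n : ℝ) := by
      simpa [norm_smul, lp.norm_single] using ha
    have hnN : (n : ℝ) ≤ N + 1 :=
      le_of_one_div_le_one_div (by linarith) (hN.le.trans hδn)
    have hdist := (Metric.edist_le_ediam_of_mem haA hb).trans_lt hdiam
    rw [edist_lt_ofReal] at hdist
    have hge := atsujiSubset_dist_ge hn (hA hb) hne
    have : 1 / (((N : ℝ) + 1) * (N + 2)) ≤ 1 / ((n : ℝ) * (n + 1)) :=
      one_div_le_one_div_of_le (by positivity) (by nlinarith)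
    linarith
  · exact absurd (mem_ball_self hδ) ha

theorem not_totallyBounded_atsujiSubset : ¬ TotallyBounded atsujiSubset := by
  intro h
  obtain ⟨t, ht, hcov⟩ := Metric.totallyBounded_iff.1 h (1 / 2) (by norm_num)
  have hmem (m : ℕ) : lp.single 1 (m + 1) (1 : ℝ) ∈ atsujiSubset :=
    Or.inl ⟨m + 1, 1, by omega, le_rfl, by simp⟩
  have hex (m : ℕ) : ∃ y ∈ t, dist (lp.single 1 (m + 1) (1 : ℝ)) y < 1 / 2 := by
    simpa using hcov (hmem m)
  choose f hft hf using hex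
  refine Set.infinite_of_injective_forall_mem (f := f) (fun m k hmk => ?_) hft ht
  by_contra hne
  have h1 : dist (lp.single 1 (m + 1) (1 : ℝ)) (lp.single (E := fun _ : ℕ => ℝ) 1 (k + 1) 1) < 1 := by
    have hk := hf k
    rw [← hmk] at hk
    linarith [dist_triangle_right (lp.single 1 (m + 1) (1 : ℝ))
      (lp.single (E := fun _ : ℕ => ℝ) 1 (k + 1) 1) (f m), hf m]
  rw [dist_eq_norm] at h1
  have h2 := (lp.norm_apply_le_norm one_ne_zero _ (m + 1)).trans_lt h1
  simp [hne] at h2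

/-- In the Banach space `ℓ¹`, the set `S = {e_m / n : m, n ≥ 1} ∪ {0}` is
such that every cover of `S` by open subsets of `ℓ¹` has a Lebesgue number, yet `S` is not
totally bounded. -/
theorem statement_3 :
    (∀ 𝒪 : Set (Set (lp (fun _ : ℕ => ℝ) 1)), (∀ O ∈ 𝒪, IsOpen O) → atsujiSubset ⊆ ⋃₀ 𝒪 →
      ∃ α, IsLebesgueNumberFor α 𝒪 atsujiSubset) ∧
    ¬ TotallyBounded atsujiSubset := by
  exact ⟨fun _ hopen hcov => atsujiSubset_exists_lebesgueNumber hopen hcov,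
    not_totallyBounded_atsujiSubset⟩
end

section
/- Let S be a subset of a metric space X. Then S is totally bounded if and only if every locally finite cover of S by open subsets of X that has a Lebesgue number admits a finite subcover of S. -/
open Metric Set

/-- A set that is not totally bounded contains a uniformly separated sequence. -/
theorem exists_separated_seq_of_not_totallyBounded {X : Type*} [MetricSpace X] {S : Set X}
    (hS : ¬ TotallyBounded S) :
    ∃ ε > 0, ∃ u : ℕ → X, (∀ n, u n ∈ S) ∧ ∀ m n, m ≠ n → ε ≤ dist (u m) (u n) := by
  rw [Metric.totallyBounded_iff] at hS
  push Not at hS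
  obtain ⟨ε, hε, h⟩ := hS
  obtain ⟨u, hu⟩ := Set.seq_of_forall_finite_exists
    (P := fun (c : X) t => c ∈ S ∧ ∀ y ∈ t, ε ≤ dist c y) fun t ht => by
      obtain ⟨c, hc, hct⟩ := Set.not_subset.1 (h t ht)
      refine ⟨c, hc, fun y hy => ?_⟩
      by_contra! hlt
      exact hct (mem_biUnion hy hlt)
  refine ⟨ε, hε, u, fun n => (hu n).1, fun m n hmn => ?_⟩
  rcases hmn.lt_or_gt with hlt | hlt
  · rw [dist_comm]
    exact (hu n).2 _ (mem_image_of_mem u hlt)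
  · exact (hu m).2 _ (mem_image_of_mem u hlt)

/-- A cover of a totally bounded set with a Lebesgue number has a finite subcover. -/
theorem TotallyBounded.exists_finite_subcover_of_isLebesgueNumberFor {X : Type*} [MetricSpace X]
    {S : Set X} (hS : TotallyBounded S) {𝒪 : Set (Set X)} {α : ℝ}
    (hα : IsLebesgueNumberFor α 𝒪 S) : ∃ F ⊆ 𝒪, F.Finite ∧ S ⊆ ⋃₀ F := by
  obtain ⟨hα, hL⟩ := hα
  obtain ⟨t, ht, hSt⟩ := Metric.totallyBounded_iff.1 hS (α / 3) (by positivity)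
  have hO (y : X) : ∃ O ∈ 𝒪, S ∩ ball y (α / 3) ⊆ O := by
    refine hL _ inter_subset_left (lt_of_le_of_lt (ediam_le (d := ENNReal.ofReal (2 * α / 3)) ?_)
      ((ENNReal.ofReal_lt_ofReal_iff hα).2 (by linarith)))
    rintro a ⟨-, ha⟩ b ⟨-, hb⟩
    rw [edist_dist]
    refine ENNReal.ofReal_le_ofReal ?_
    rw [mem_ball] at ha hb
    linarith [dist_triangle_right a b y]
  choose O hO hSO using hO
  refine ⟨O '' t, image_subset_iff.2 fun y _ => hO y, ht.image O, fun x hx => ?_⟩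
  obtain ⟨y, hy, hxy⟩ := mem_iUnion₂.1 (hSt hx)
  exact ⟨O y, mem_image_of_mem O hy, hSO y ⟨hx, hxy⟩⟩

/-- A subset `S` of a metric space `X` is totally bounded if and only if
every locally finite cover of `S` by open subsets of `X` that has a Lebesgue number admits a
finite subcover of `S`. -/
theorem statement_4 {X : Type*} [MetricSpace X] (S : Set X) :
    TotallyBounded S ↔
      ∀ 𝒪 : Set (Set X), (∀ O ∈ 𝒪, IsOpen O) → S ⊆ ⋃₀ 𝒪 → LocallyFiniteFamily 𝒪 →
        (∃ α, IsLebesgueNumberFor α 𝒪 S) → ∃ F ⊆ 𝒪, F.Finite ∧ S ⊆ ⋃₀ F := by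
  refine ⟨fun hS 𝒪 _ _ _ ⟨α, hα⟩ =>
    hS.exists_finite_subcover_of_isLebesgueNumberFor hα, fun H => ?_⟩
  by_contra hS
  obtain ⟨ε, hε, u, huS, hu⟩ := exists_separated_seq_of_not_totallyBounded hS
  let V : Set X := (closure (range u))ᶜ
  let B : ℕ → Set X := fun n => ball (u n) (ε / 3)
  have hL : ∀ A : Set X, ediam A < ENNReal.ofReal (ε / 12) →
      ∃ O ∈ insert V (range B), A ⊆ O := by
    intro A hA
    by_cases h : ∃ a ∈ A, ∃ n, dist a (u n) ≤ ε / 6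
    · obtain ⟨a, ha, n, hn⟩ := h
      refine ⟨B n, .inr ⟨n, rfl⟩, fun b hb => mem_ball.2 ?_⟩
      have hab : dist b a < ε / 12 := by
        have := (edist_le_ediam_of_mem hb ha).trans_lt hA
        rwa [edist_dist, ENNReal.ofReal_lt_ofReal_iff (by positivity)] at this
      linarith [dist_triangle b a (u n)]
    · push Not at h
      refine ⟨V, .inl rfl, fun a ha hcl => ?_⟩
      obtain ⟨-, ⟨n, rfl⟩, hn⟩ := Metric.mem_closure_iff.1 hcl (ε / 6) (by positivity)
      exact (h a ha n).not_gt hn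
  have hopen : ∀ O ∈ insert V (range B), IsOpen O := by
    rintro O (rfl | ⟨n, rfl⟩)
    · exact isClosed_closure.isOpen_compl
    · exact isOpen_ball
  have hcover : S ⊆ ⋃₀ insert V (range B) := by
    intro x _
    obtain ⟨O, hO, hxO⟩ := hL {x} (by simpa using hε)
    exact ⟨O, hO, hxO rfl⟩
  have hfin : LocallyFiniteFamily (insert V (range B)) := by
    intro x
    refine ⟨ball x (ε / 12), ball_mem_nhds x (by positivity), ?_⟩
    have hsub : {O ∈ range B | (O ∩ ball x (ε / 12)).Nonempty}.Subsingleton := by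
      rintro - ⟨⟨m, rfl⟩, a, ham, hax⟩ - ⟨⟨n, rfl⟩, b, hbn, hbx⟩
      by_cases hmn : m = n
      · rw [hmn]
      · have := hu m n hmn
        rw [mem_ball] at ham hax hbn hbx
        linarith [dist_triangle (u m) a (u n), dist_triangle a x (u n), dist_triangle x b (u n),
          dist_comm a (u m), dist_comm b x]
    refine (hsub.finite.insert V).subset ?_
    rintro O ⟨rfl | hO, hne⟩
    · exact .inl rfl
    · exact .inr ⟨hO, hne⟩
  obtain ⟨F, hF, hFfin, hSF⟩ := H (insert V (range B)) hopen hcover hfin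
    ⟨ε / 12, by positivity, fun A _ => hL A⟩
  have hBF (n : ℕ) : B n ∈ F := by
    obtain ⟨O, hOF, hO⟩ := hSF (huS n)
    rcases hF hOF with rfl | ⟨m, rfl⟩
    · exact absurd (subset_closure (mem_range_self n)) hO
    · by_cases hmn : n = m
      · rwa [hmn]
      · linarith [hu n m hmn, mem_ball.1 hO]
  have hB : Function.Injective B := fun m n hmn => by
    by_contra hne
    have : u m ∈ B n := hmn ▸ mem_ball_self (by positivity)
    linarith [hu m n hne, mem_ball.1 this]
  exact infinite_of_injective_forall_mem hB hBF hFfin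
end

section
/- Let S be a subset of a complete metric space X. Then S is totally bounded if and only if every locally finite cover of S by open subsets of X has a finite subcover of S. -/
open Metric Set

/-- A subset `S` of a complete metric space `X` is totally bounded if and
only if every locally finite cover of `S` by open subsets of `X` has a finite subcover
of `S`. -/
theorem statement_5 {X : Type*} [MetricSpace X] [CompleteSpace X] (S : Set X) :
    TotallyBounded S ↔
      ∀ 𝒪 : Set (Set X), (∀ O ∈ 𝒪, IsOpen O) → S ⊆ ⋃₀ 𝒪 → LocallyFiniteFamily 𝒪 →
        ∃ F ⊆ 𝒪, F.Finite ∧ S ⊆ ⋃₀ F := by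
  constructor
  · intro hS 𝒪 _ hcover hlf
    have hcompact : IsCompact (closure S) := hS.closure.isCompact_of_isClosed isClosed_closure
    have hlf' : LocallyFinite (fun O : 𝒪 => (O : Set X)) := by
      intro x
      obtain ⟨U, hU, hfin⟩ := hlf x
      refine ⟨U, hU, ?_⟩
      refine Set.Finite.of_finite_image (hfin.subset ?_) Subtype.val_injective.injOn
      rintro _ ⟨O, hO, rfl⟩
      exact ⟨O.2, hO⟩
    have hfin := hlf'.finite_nonempty_inter_compact hcompact
    refine ⟨_, ?_, hfin.image Subtype.val, ?_⟩
    · rintro _ ⟨O, -, rfl⟩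
      exact O.2
    · intro x hx
      obtain ⟨O, hO, hxO⟩ := hcover hx
      exact ⟨O, ⟨⟨O, hO⟩, ⟨x, hxO, subset_closure hx⟩, rfl⟩, hxO⟩
  · intro h
    refine Metric.totallyBounded_iff.2 fun ε hε => ?_
    obtain ⟨v, hvo, hvc, hvlf, hvsub⟩ := precise_refinement (fun x : X => ball x ε)
      (fun _ => isOpen_ball) (iUnion_eq_univ_iff.2 fun x => ⟨x, mem_ball_self hε⟩)
    obtain ⟨t, -, ht, hSt⟩ := exists_subset_image_finite_and.1
      (h (v '' univ) (forall_mem_image.2 fun x _ => hvo x)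
        (by rw [image_univ, sUnion_range, hvc]; exact subset_univ S) (by
          intro x
          obtain ⟨U, hU, hfin⟩ := hvlf x
          refine ⟨U, hU, (hfin.image v).subset ?_⟩
          rintro _ ⟨⟨i, -, rfl⟩, hi⟩
          exact ⟨i, hi, rfl⟩))
    refine ⟨t, ht, fun x hx => ?_⟩
    obtain ⟨_, ⟨i, hi, rfl⟩, hxi⟩ := hSt hx
    exact mem_biUnion hi (hvsub i hxi)
end

section
/- Let S be a nonempty subset of an Atsuji metric space X. Then the metric subspace S is finitely chainable if and only if every locally finite cover of S by open subsets of X has a finite subcover of S. -/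
open Metric Set

/-- Every continuous map from an Atsuji space to a metric space is uniformly continuous. -/
theorem IsAtsuji.uniformContinuous {X Y : Type*} [MetricSpace X] [PseudoMetricSpace Y]
    (hX : IsAtsuji X) {f : X → Y} (hf : Continuous f) : UniformContinuous f := by
  rw [Metric.uniformContinuous_iff]
  intro ε hε
  obtain ⟨α, hα, h⟩ := hX (range fun y : Y => f ⁻¹' ball y (ε / 2))
    (by rintro _ ⟨y, rfl⟩; exact isOpen_ball.preimage hf)
    (eq_univ_of_forall fun x => ⟨_, ⟨f x, rfl⟩, mem_ball_self (half_pos hε)⟩)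
  refine ⟨α, hα, fun {a b} hab => ?_⟩
  obtain ⟨_, ⟨y, rfl⟩, hy⟩ := h {a, b} (subset_univ _) (by
    change Metric.ediam {a, b} < _
    rw [Metric.ediam_pair, edist_dist]
    exact (ENNReal.ofReal_lt_ofReal_iff hα).2 hab)
  have ha : dist (f a) y < ε / 2 := hy (mem_insert _ _)
  have hb : dist (f b) y < ε / 2 := hy (mem_insert_of_mem _ rfl)
  linarith [dist_triangle_right (f a) (f b) y]

/-- Along a chain whose steps move `f` by at most `1`, the total change of `f` is at most the
length of the chain. -/
theorem IsEpsChain.le_add {X : Type*} [MetricSpace X] {ε : ℝ} {n : ℕ} {a : ℕ → X} {x y : X}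
    (h : IsEpsChain ε n a x y) {f : X → ℝ}
    (hf : ∀ u v, dist u v ≤ ε → f u ≤ f v + 1) : f x ≤ f y + n := by
  obtain ⟨rfl, rfl, h⟩ := h
  induction n with
  | zero => simp
  | succ k ih =>
    have h₁ := ih fun i hi => h i (hi.trans k.lt_succ_self)
    have h₂ := hf _ _ (h k k.lt_succ_self)
    push_cast
    linarith

/-- Uniformly continuous real functions on a finitely chainable space are bounded above. -/
theorem FinitelyChainable.bddAbove_range {X : Type*} [MetricSpace X] (hX : FinitelyChainable X)
    {f : X → ℝ} (hf : UniformContinuous f) : BddAbove (range f) := by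
  obtain ⟨δ, hδ, h⟩ := Metric.uniformContinuous_iff.1 hf 1 one_pos
  obtain ⟨P, m, hP⟩ := hX (δ / 2) (half_pos hδ)
  obtain ⟨C, hC⟩ := (P.finite_toSet.image f).bddAbove
  refine ⟨C + m, ?_⟩
  rintro _ ⟨x, rfl⟩
  obtain ⟨p, hp, a, ha⟩ := hP x
  have h₁ := ha.le_add (f := f) fun u v huv => by
    have := h (huv.trans_lt (half_lt_self hδ))
    rw [Real.dist_eq] at this
    linarith [le_abs_self (f u - f v)]
  linarith [hC (mem_image_of_mem f hp)]

/-- If a locally finite family covering `S` has no finite subfamily covering `S`, then some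
continuous real function is unbounded on `S`. -/
theorem LocallyFiniteFamily.exists_continuous_eq_natCast {X : Type*} [MetricSpace X] {S : Set X}
    {𝒪 : Set (Set X)} (h𝒪 : LocallyFiniteFamily 𝒪) (hcov : S ⊆ ⋃₀ 𝒪)
    (hfin : ¬∃ F ⊆ 𝒪, F.Finite ∧ S ⊆ ⋃₀ F) :
    ∃ g : C(X, ℝ), ∀ n : ℕ, ∃ x ∈ S, g x = n := by
  classical
  obtain ⟨p, hp, hlt⟩ := exists_seq_of_forall_finset_exists
    (fun p : X × Set X => p.1 ∈ S ∧ p.2 ∈ 𝒪 ∧ p.1 ∈ p.2) (fun p q => q.1 ∉ p.2) (by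
      intro s hs
      by_contra! hne
      refine hfin ⟨Prod.snd '' (s : Set (X × Set X)), ?_, s.finite_toSet.image _, fun x hx => ?_⟩
      · rintro _ ⟨q, hq, rfl⟩
        exact (hs q hq).2.1
      · obtain ⟨O, hO, hxO⟩ := hcov hx
        obtain ⟨q, hq, hxq⟩ := hne (x, O) ⟨hx, hO, hxO⟩
        exact ⟨_, mem_image_of_mem _ hq, hxq⟩)
  have hinj₁ : Function.Injective fun n => (p n).1 := by
    refine Function.Injective.of_lt_imp_ne fun m n hmn he => hlt m n hmn ?_
    have he : (p m).1 = (p n).1 := he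
    exact he ▸ (hp m).2.2
  have hinj₂ : Function.Injective fun n => (p n).2 := by
    refine Function.Injective.of_lt_imp_ne fun m n hmn he => hlt m n hmn ?_
    have he : (p m).2 = (p n).2 := he
    exact he ▸ (hp n).2.2
  have hlf : LocallyFinite fun n => ({(p n).1} : Set X) := by
    refine LocallyFinite.subset (f := fun n => (p n).2) (fun x => ?_)
      fun n => singleton_subset_iff.2 (hp n).2.2
    obtain ⟨U, hU, hUf⟩ := h𝒪 x
    exact ⟨U, hU, (hUf.preimage hinj₂.injOn).subset fun n hn => ⟨(hp n).2.1, hn⟩⟩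
  have hemb : Topology.IsClosedEmbedding fun n => (p n).1 := by
    refine .of_continuous_injective_isClosedMap continuous_of_discreteTopology hinj₁ fun s _ => ?_
    have := (hlf.comp_injective (Subtype.val_injective (p := (· ∈ s)))).isClosed_iUnion
      fun _ => isClosed_singleton
    convert this using 1
    ext x
    simp [eq_comm]
  obtain ⟨g, hg⟩ := ContinuousMap.exists_extension' hemb
    (⟨fun n : ℕ => (n : ℝ), continuous_of_discreteTopology⟩ : C(ℕ, ℝ))
  exact ⟨g, fun n => ⟨_, (hp n).1, congrFun hg n⟩⟩

/-- The graph joining two distinct points when their distance is at most `ε`. -/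
def epsGraph (X : Type*) [MetricSpace X] (ε : ℝ) : SimpleGraph X where
  Adj x y := x ≠ y ∧ dist x y ≤ ε
  symm := ⟨fun x y h => ⟨h.1.symm, dist_comm x y ▸ h.2⟩⟩
  loopless := ⟨fun _ h => h.1 rfl⟩

theorem epsGraph_reachable_of_dist_le {X : Type*} [MetricSpace X] {ε : ℝ} {x y : X}
    (h : dist x y ≤ ε) : (epsGraph X ε).Reachable x y := by
  by_cases hxy : x = y
  · exact hxy ▸ .refl x
  · exact SimpleGraph.Adj.reachable ⟨hxy, h⟩

theorem epsGraph_dist_le_dist_add_one {X : Type*} [MetricSpace X] {ε : ℝ} {x y z : X}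
    (h : dist x y ≤ ε) (hyz : (epsGraph X ε).Reachable y z) :
    (epsGraph X ε).dist x z ≤ (epsGraph X ε).dist y z + 1 := by
  by_cases hxy : x = y
  · subst hxy
    exact Nat.le_succ _
  · obtain ⟨w, hw⟩ := hyz.exists_walk_length_eq_dist
    have hadj : (epsGraph X ε).Adj x y := ⟨hxy, h⟩
    simpa [hw] using SimpleGraph.dist_le (w.cons hadj)

/-- Points at graph distance at most `n` are joined by an `ε`-chain of length exactly `n`. -/
theorem exists_isEpsChain_of_epsGraph_dist_le {X : Type*} [MetricSpace X] {ε : ℝ} (hε : 0 ≤ ε)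
    {x y : X} (h : (epsGraph X ε).Reachable x y) {n : ℕ} (hn : (epsGraph X ε).dist x y ≤ n) :
    ∃ a, IsEpsChain ε n a x y := by
  obtain ⟨w, hw⟩ := h.exists_walk_length_eq_dist
  refine ⟨w.getVert, w.getVert_zero, w.getVert_of_length_le (hw ▸ hn), fun i _ => ?_⟩
  rcases lt_or_ge i w.length with hi | hi
  · exact (w.adj_getVert_succ hi).2
  · rw [w.getVert_of_length_le hi, w.getVert_of_length_le (hi.trans i.le_succ), dist_self]
    exact hε

/-- The component of a point in the `ε`-graph, with its graph distance to the chosen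
representative of that component. -/
noncomputable def epsLevel (X : Type*) [MetricSpace X] (ε : ℝ) (x : X) :
    (epsGraph X ε).ConnectedComponent × ℕ :=
  ((epsGraph X ε).connectedComponentMk x,
    (epsGraph X ε).dist x ((epsGraph X ε).connectedComponentMk x).out)

theorem epsGraph_reachable_out {X : Type*} [MetricSpace X] (ε : ℝ) (x : X) :
    (epsGraph X ε).Reachable x ((epsGraph X ε).connectedComponentMk x).out :=
  (SimpleGraph.ConnectedComponent.exact (Quot.out_eq _)).symm

theorem epsLevel_of_dist_le {X : Type*} [MetricSpace X] {ε : ℝ} {x y : X} (h : dist x y ≤ ε) :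
    (epsLevel X ε x).1 = (epsLevel X ε y).1 ∧ (epsLevel X ε x).2 ≤ (epsLevel X ε y).2 + 1 := by
  have hc : (epsGraph X ε).connectedComponentMk x = (epsGraph X ε).connectedComponentMk y :=
    SimpleGraph.ConnectedComponent.sound (epsGraph_reachable_of_dist_le h)
  refine ⟨hc, ?_⟩
  simp only [epsLevel, hc]
  exact epsGraph_dist_le_dist_add_one h (epsGraph_reachable_out ε y)

/-- The thickenings of the fibres of a map on `S` form a locally finite family if the map takes
only finitely many values near each point at scale `ε`. -/
theorem locallyFiniteFamily_range_thickening {X ι : Type*} [MetricSpace X] {S : Set X} {ε : ℝ}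
    (hε : 0 < ε) {l : S → ι} (hl : ∀ x, (l '' closedBall x ε).Finite) :
    LocallyFiniteFamily
      (range fun i => thickening (ε / 4) (Subtype.val '' (l ⁻¹' {i}) : Set X)) := by
  intro y
  refine ⟨ball y (ε / 4), ball_mem_nhds y (by positivity), ?_⟩
  have key : ∀ i, (thickening (ε / 4) (Subtype.val '' (l ⁻¹' {i}) : Set X) ∩
      ball y (ε / 4)).Nonempty → ∃ x : S, l x = i ∧ dist (x : X) y < ε / 2 := by
    rintro i ⟨z, hz, hzy⟩
    obtain ⟨_, ⟨x, hx, rfl⟩, hzx⟩ := mem_thickening_iff.1 hz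
    refine ⟨x, hx, ?_⟩
    linarith [dist_triangle_left (x : X) y z, mem_ball.1 hzy]
  rcases isEmpty_or_nonempty {x : S // dist (x : X) y < ε / 2} with he | ⟨⟨x₀, hx₀⟩⟩
  · convert finite_empty
    refine eq_empty_of_forall_notMem ?_
    rintro _ ⟨⟨i, rfl⟩, hi⟩
    obtain ⟨x, -, hx⟩ := key i hi
    exact he.false ⟨x, hx⟩
  · refine ((hl x₀).image fun i =>
      thickening (ε / 4) (Subtype.val '' (l ⁻¹' {i}) : Set X)).subset ?_
    rintro _ ⟨⟨i, rfl⟩, hi⟩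
    obtain ⟨x, rfl, hx⟩ := key i hi
    refine mem_image_of_mem _ ⟨x, ?_, rfl⟩
    rw [mem_closedBall, Subtype.dist_eq]
    linarith [dist_triangle_right (x : X) x₀ y]

theorem finite_image_epsLevel_closedBall {X : Type*} [MetricSpace X] (ε : ℝ) (x : X) :
    (epsLevel X ε '' closedBall x ε).Finite := by
  refine ((finite_singleton (epsLevel X ε x).1).prod
    (finite_Iic ((epsLevel X ε x).2 + 1))).subset ?_
  rintro _ ⟨y, hy, rfl⟩
  exact epsLevel_of_dist_le hy

/-- A subset of a metric space is finitely chainable if each of its locally finite covers by open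
sets of the ambient space has a finite subcover. -/
theorem finitelyChainable_of_forall_finite_subcover {X : Type*} [MetricSpace X] {S : Set X}
    (h : ∀ 𝒪 : Set (Set X), (∀ O ∈ 𝒪, IsOpen O) → S ⊆ ⋃₀ 𝒪 → LocallyFiniteFamily 𝒪 →
      ∃ F ⊆ 𝒪, F.Finite ∧ S ⊆ ⋃₀ F) : FinitelyChainable S := by
  classical
  intro ε hε
  obtain ⟨F, hF, hFfin, hSF⟩ := h
    (range fun i => thickening (ε / 4) (Subtype.val '' (epsLevel S ε ⁻¹' {i}) : Set X))
    (by rintro _ ⟨i, rfl⟩; exact isOpen_thickening)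
    (fun x hx => ⟨_, ⟨epsLevel S ε ⟨x, hx⟩, rfl⟩,
      self_subset_thickening (by positivity) _ ⟨⟨x, hx⟩, rfl, rfl⟩⟩)
    (locallyFiniteFamily_range_thickening hε (finite_image_epsLevel_closedBall (X := S) ε))
  obtain ⟨T, rfl⟩ := hFfin.exists_finset_coe
  obtain ⟨T, -, rfl⟩ := Finset.subset_set_image_iff.1 (by rwa [← image_univ] at hF)
  refine ⟨T.image fun i => i.1.out, T.sup Prod.snd + 1, fun x => ?_⟩
  obtain ⟨_, hO, hxO⟩ := hSF x.2
  obtain ⟨i, hi, rfl⟩ := Finset.mem_image.1 hO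
  obtain ⟨_, ⟨y, hy, rfl⟩, hxy⟩ := mem_thickening_iff.1 hxO
  obtain rfl : epsLevel S ε y = i := hy
  obtain ⟨hc, hd⟩ := epsLevel_of_dist_le (ε := ε) (x := x) (y := y) (by
    rw [Subtype.dist_eq]
    linarith)
  refine ⟨_, Finset.mem_image_of_mem _ hi, ?_⟩
  rw [← hc]
  exact exists_isEpsChain_of_epsGraph_dist_le hε.le (epsGraph_reachable_out ε x)
    (hd.trans (Nat.succ_le_succ (Finset.le_sup (f := Prod.snd) hi)))

/-- Let `S` be a nonempty subset of an Atsuji metric space `X`. Then the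
metric subspace `S` is finitely chainable if and only if every locally finite cover of `S`
by open subsets of `X` has a finite subcover of `S`. -/
theorem statement_6 {X : Type*} [MetricSpace X] (hX : IsAtsuji X) (S : Set X)
    (hS : S.Nonempty) :
    FinitelyChainable ↥S ↔
      ∀ 𝒪 : Set (Set X), (∀ O ∈ 𝒪, IsOpen O) → S ⊆ ⋃₀ 𝒪 → LocallyFiniteFamily 𝒪 →
        ∃ F ⊆ 𝒪, F.Finite ∧ S ⊆ ⋃₀ F := by
  refine ⟨fun h 𝒪 _ hcov hlf => ?_, finitelyChainable_of_forall_finite_subcover⟩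
  by_contra hfin
  obtain ⟨g, hg⟩ := hlf.exists_continuous_eq_natCast hcov hfin
  obtain ⟨C, hC⟩ := h.bddAbove_range
    ((hX.uniformContinuous g.continuous).comp uniformContinuous_subtype_val)
  obtain ⟨n, hn⟩ := exists_nat_gt C
  obtain ⟨x, hx, hgx⟩ := hg n
  exact (hC ⟨⟨x, hx⟩, hgx⟩).not_gt hn
end

section
/- Every complete metrically convex metric space X has the property P: for every x ∈ X and every real r with 0 ≤ r < sup_{y ∈ X} d(x, y), there exists z ∈ X with d(x, z) = r. -/
open Metric Set

/-- **Caristi–Ekeland principle** for continuous functions: a continuous function bounded below on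
a nonempty complete metric space has a point that is maximal for the order
`p ≤ q ↔ dist p q ≤ φ p - φ q`. -/
theorem exists_forall_dist_le_sub_imp_eq {Y : Type*} [MetricSpace Y] [CompleteSpace Y] [Nonempty Y]
    {φ : Y → ℝ} (hφ : Continuous φ) (hbdd : BddBelow (range φ)) :
    ∃ m, ∀ a, dist m a ≤ φ m - φ a → a = m := by
  suffices ∃ m, ∀ a, dist m a ≤ φ m - φ a → dist a m ≤ φ a - φ m by
    obtain ⟨m, hm⟩ := this
    refine ⟨m, fun a ha => dist_le_zero.1 ?_⟩
    linarith [hm a ha, dist_comm m a]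
  refine exists_maximal_of_nonempty_chains_bounded
    (r := fun p q : Y => dist p q ≤ φ p - φ q) ?_ ?_
  · intro c hc hne
    have hbc : BddBelow (φ '' c) := hbdd.mono (image_subset_range φ c)
    have hdist : ∀ p ∈ c, ∀ q ∈ c, dist p q ≤ |φ p - φ q| := by
      intro p hp q hq
      rcases eq_or_ne p q with rfl | hpq
      · simp
      rcases hc hp hq hpq with h | h
      · exact h.trans (le_abs_self _)
      · rw [dist_comm, abs_sub_comm]
        exact h.trans (le_abs_self _)
    obtain ⟨u, -, hu, huc⟩ := exists_seq_tendsto_sInf (hne.image φ) hbc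
    choose p hpc hpu using huc
    have hp : Filter.Tendsto (fun n => φ (p n)) Filter.atTop (nhds (sInf (φ '' c))) := by
      simpa only [hpu] using hu
    have hcauchy : CauchySeq p := by
      rw [Metric.cauchySeq_iff]
      intro ε hε
      obtain ⟨N, hN⟩ := Metric.cauchySeq_iff.1 hp.cauchySeq ε hε
      exact ⟨N, fun i hi j hj => (hdist _ (hpc i) _ (hpc j)).trans_lt (hN i hi j hj)⟩
    obtain ⟨q, hq⟩ := cauchySeq_tendsto_of_complete hcauchy
    have hφq : φ q = sInf (φ '' c) := tendsto_nhds_unique ((hφ.tendsto q).comp hq) hp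
    refine ⟨q, fun z hz => ?_⟩
    have hle : φ q ≤ φ z := hφq ▸ csInf_le hbc (mem_image_of_mem φ hz)
    rw [← abs_of_nonneg (sub_nonneg.2 hle)]
    exact le_of_tendsto_of_tendsto' (tendsto_const_nhds.dist hq)
      (tendsto_const_nhds.sub ((hφ.tendsto q).comp hq)).abs fun n => hdist z hz _ (hpc n)
  · intro a b c hab hbc
    linarith [dist_triangle a b c]

/-- **Menger's theorem**: a complete metrically convex metric space is Menger convex. -/
theorem MetricallyConvex.mengerConvex {X : Type*} [MetricSpace X] [CompleteSpace X]
    (h : MetricallyConvex X) : MengerConvex X := by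
  intro x y r hr hrxy
  let S : Set (X × X) := {p | dist x p.1 + dist p.1 p.2 + dist p.2 y ≤ dist x y ∧
    dist x p.1 ≤ r ∧ dist p.2 y ≤ dist x y - r}
  have hS : IsClosed S := by
    refine IsClosed.and (isClosed_le ?_ ?_) (IsClosed.and (isClosed_le ?_ ?_) (isClosed_le ?_ ?_))
      <;> fun_prop
  have := hS.completeSpace_coe
  have : Nonempty S := ⟨⟨(x, y), by simp, by simpa using hr, by simpa using hrxy⟩⟩
  obtain ⟨⟨⟨a, b⟩, hab, ha, hb⟩, hmax⟩ := exists_forall_dist_le_sub_imp_eq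
    (φ := fun p : S => dist p.1.1 p.1.2) (by fun_prop)
    ⟨0, by rintro _ ⟨p, rfl⟩; exact dist_nonneg⟩
  simp only at hab ha hb
  obtain rfl | hne := eq_or_ne a b
  · exact ⟨a, ha, by rwa [dist_comm]⟩
  exfalso
  obtain ⟨z, hza, hzb, hz⟩ := h a b hne
  rcases le_total (dist x z) r with hxz | hxz
  · have key := hmax ⟨(z, b), by simp only; linarith [dist_triangle x a z], hxz, hb⟩
      (by simp [Subtype.dist_eq, Prod.dist_eq]; linarith)
    simp only [Subtype.mk.injEq, Prod.mk.injEq] at key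
    exact hza key.1
  · have key := hmax ⟨(a, z), by simp only; linarith [dist_triangle z b y], ha, by
        simp only; linarith [dist_triangle x a z, dist_triangle z b y]⟩
      (by simp [Subtype.dist_eq, Prod.dist_eq]; linarith [dist_comm b z])
    simp only [Subtype.mk.injEq, Prod.mk.injEq] at key
    exact hzb key.2

/-- Every complete metrically convex metric space has property `P`. -/
theorem statement_10 {X : Type*} [MetricSpace X] [CompleteSpace X]
    (h : MetricallyConvex X) : PropertyP X := by
  intro x r hr hlt
  obtain ⟨y, hy⟩ := lt_iSup_iff.1 hlt
  rw [edist_dist, ENNReal.ofReal_lt_ofReal_iff_of_nonneg hr] at hy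
  obtain ⟨z, hxz, hyz⟩ := h.mengerConvex x y r hr hy.le
  exact ⟨z, by linarith [dist_triangle x z y, dist_comm y z]⟩
end

section
/- Let X = {(x, 0) : x ∈ ℝ} ∪ {(x, 1) : x ∈ ℝ} ⊆ ℝ², the union of two distinct parallel lines, equipped with the Euclidean metric. Then X has the property P, but X is neither chainable nor metrically convex. -/
open Metric Set

theorem one_le_dist_of_apply_one_ne {p q : {p : EuclideanSpace ℝ (Fin 2) // p 1 = 0 ∨ p 1 = 1}}
    (h : p.1 1 ≠ q.1 1) : 1 ≤ dist p q := by
  have hle : dist (p.1 1) (q.1 1) ≤ dist p q := by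
    rw [Subtype.dist_eq, dist_eq_norm, dist_eq_norm]
    exact PiLp.norm_apply_le (p.1 - q.1) 1
  refine le_trans (le_of_eq ?_) hle
  rcases p.2 with hp | hp <;> rcases q.2 with hq | hq <;> simp_all

theorem IsEpsChain.map_eq_of_forall {X Y : Type*} [MetricSpace X] {f : X → Y} {ε : ℝ} {n : ℕ}
    {a : ℕ → X} {x y : X} (h : IsEpsChain ε n a x y)
    (hf : ∀ u v, dist u v ≤ ε → f u = f v) : f x = f y := by
  obtain ⟨rfl, rfl, hstep⟩ := h
  have key : ∀ i ≤ n, f (a 0) = f (a i) := by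
    intro i
    induction i with
    | zero => exact fun _ => rfl
    | succ k ih => exact fun hk => (ih (by lia)).trans (hf _ _ (hstep k (by lia)))
  exact key n le_rfl

/-- The union of two distinct parallel lines
`X = {(x, 0) : x ∈ ℝ} ∪ {(x, 1) : x ∈ ℝ} ⊆ ℝ²`, with the Euclidean metric, has property `P`
but is neither chainable nor metrically convex. -/
theorem statement_12 :
    PropertyP {p : EuclideanSpace ℝ (Fin 2) // p 1 = 0 ∨ p 1 = 1} ∧
    ¬ Chainable {p : EuclideanSpace ℝ (Fin 2) // p 1 = 0 ∨ p 1 = 1} ∧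
    ¬ MetricallyConvex {p : EuclideanSpace ℝ (Fin 2) // p 1 = 0 ∨ p 1 = 1} := by
  let x : {p : EuclideanSpace ℝ (Fin 2) // p 1 = 0 ∨ p 1 = 1} := ⟨!₂[0, 0], by simp⟩
  let y : {p : EuclideanSpace ℝ (Fin 2) // p 1 = 0 ∨ p 1 = 1} := ⟨!₂[0, 1], by simp⟩
  have hxy : x.1 1 ≠ y.1 1 := by simp [x, y]
  refine ⟨fun p r hr _ => ?_, fun hc => ?_, fun hm => ?_⟩
  · refine ⟨⟨p.1 + EuclideanSpace.single 0 r, by simpa using p.2⟩, ?_⟩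
    simp [Subtype.dist_eq, abs_of_nonneg hr]
  · obtain ⟨n, a, ha⟩ := hc (1 / 2) (by norm_num) x y
    refine hxy (ha.map_eq_of_forall (f := fun p => p.1 1) fun u v huv => ?_)
    by_contra hne
    linarith [one_le_dist_of_apply_one_ne hne]
  · have hd : dist x y = 1 := by simp [Subtype.dist_eq, EuclideanSpace.dist_eq, x, y]
    obtain ⟨z, hzx, hzy, hz⟩ := hm x y fun h => hxy (by rw [h])
    have hxz : 0 < dist x z := dist_pos.2 hzx.symm
    have hzy' : 0 < dist z y := dist_pos.2 hzy
    by_cases h : x.1 1 = z.1 1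
    · linarith [one_le_dist_of_apply_one_ne (h ▸ hxy)]
    · linarith [one_le_dist_of_apply_one_ne h]
end

section
/- The metric space ℚ of rational numbers (with the metric inherited from ℝ) is metrically convex and chainable, but it does not have the property P. -/
open Metric Set

/-- The metric space `ℚ` is metrically convex and chainable, but does not
have property `P`. -/
theorem statement_13 : MetricallyConvex ℚ ∧ Chainable ℚ ∧ ¬ PropertyP ℚ := by
  refine ⟨fun x y hxy => ⟨(x + y) / 2, ?_, ?_, ?_⟩, fun ε hε x y => ?_, fun hP => ?_⟩
  · intro h
    apply hxy
    linarith
  · intro h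
    apply hxy
    linarith
  · have h₁ : (x : ℝ) - (x + y) / 2 = (x - y) / 2 := by ring
    have h₂ : ((x : ℝ) + y) / 2 - y = (x - y) / 2 := by ring
    simp only [Rat.dist_eq]
    push_cast
    rw [h₁, h₂, abs_div, abs_two]
    ring
  · obtain ⟨n, hn⟩ := exists_nat_gt (dist x y / ε)
    have hn₀ : (0 : ℝ) < n := lt_of_le_of_lt (by positivity) hn
    have hn₁ : (n : ℚ) ≠ 0 := by exact_mod_cast hn₀.ne'
    refine ⟨n, fun i => x + i * ((y - x) / n), by simp, by field_simp; ring, fun i _ => ?_⟩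
    have hstep : (x : ℝ) + i * ((y - x) / n) - (x + (i + 1) * ((y - x) / n)) = (x - y) / n := by
      ring
    rw [Rat.dist_eq]
    push_cast
    rw [hstep, abs_div, Nat.abs_cast, ← Rat.dist_eq, div_le_iff₀ hn₀]
    rw [div_lt_iff₀ hε] at hn
    linarith
  · have hlt : ENNReal.ofReal (Real.sqrt 2) < ⨆ y : ℚ, edist 0 y := by
      refine lt_of_lt_of_le ?_ (le_iSup (fun y : ℚ => edist 0 y) 2)
      rw [edist_dist, Rat.dist_eq]
      refine (ENNReal.ofReal_lt_ofReal_iff (by norm_num)).2 ?_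
      rw [Real.sqrt_lt' (by norm_num)]
      norm_num
    obtain ⟨z, hz⟩ := hP 0 (Real.sqrt 2) (Real.sqrt_nonneg 2) hlt
    refine irrational_sqrt_two ⟨|z|, ?_⟩
    rw [← hz, Rat.dist_eq]
    simp
end

section
/- Let X be a chainable metric space. If every countably infinite locally finite open cover of X has a Lebesgue number, then X is totally bounded. -/
open Metric Set

/-- A space that is not totally bounded contains a uniformly separated sequence. -/
theorem exists_seq_le_dist_of_not_totallyBounded {X : Type*} [PseudoMetricSpace X]
    (hX : ¬ TotallyBounded (Set.univ : Set X)) :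
    ∃ ε > (0 : ℝ), ∃ x : ℕ → X, ∀ m n, m ≠ n → ε ≤ dist (x m) (x n) := by
  rw [Metric.totallyBounded_iff] at hX
  push Not at hX
  obtain ⟨ε, hε, hfin⟩ := hX
  have : Std.Symm fun a b : X => ε ≤ dist a b := ⟨fun a b hab => by rwa [dist_comm]⟩
  obtain ⟨x, -, hx⟩ := exists_seq_of_forall_finset_exists' (fun _ : X => True)
    (fun a b => ε ≤ dist a b) (fun s _ => by
      obtain ⟨y, -, hy⟩ := Set.not_subset.1 (hfin s s.finite_toSet)
      refine ⟨y, trivial, fun z hz => ?_⟩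
      by_contra! hlt
      exact hy (Set.mem_biUnion (Finset.mem_coe.2 hz) (by rwa [Metric.mem_ball, dist_comm])))
  exact ⟨ε, hε, x, fun m n hmn => hx hmn⟩

/-- A chainable space with at least two points has no isolated points. -/
theorem Chainable.exists_dist_le {X : Type*} [MetricSpace X] (hchain : Chainable X)
    {x z : X} (hxz : x ≠ z) {δ : ℝ} (hδ : 0 < δ) : ∃ y, 0 < dist x y ∧ dist x y ≤ δ := by
  obtain ⟨n, a, h0, hn, ha⟩ := hchain δ hδ x z
  by_contra! hiso
  have key : ∀ i ≤ n, a i = x := by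
    intro i
    induction i with
    | zero => exact fun _ => h0
    | succ i ih =>
      intro hi
      have hstep := ha i (by omega)
      rw [ih (by omega)] at hstep
      by_contra hne
      exact (hiso (a (i + 1)) (dist_pos.2 (Ne.symm hne))).not_ge hstep
  exact hxz ((key n le_rfl).symm.trans hn)

/-- Let `X` be a chainable metric space. If every countably infinite
locally finite open cover of `X` has a Lebesgue number, then `X` is totally bounded. -/
theorem statement_15 {X : Type*} [MetricSpace X] (hchain : Chainable X)
    (h : ∀ 𝒪 : Set (Set X), 𝒪.Countable → 𝒪.Infinite → (∀ O ∈ 𝒪, IsOpen O) →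
      ⋃₀ 𝒪 = Set.univ → LocallyFiniteFamily 𝒪 → ∃ α, IsLebesgueNumberFor α 𝒪 Set.univ) :
    TotallyBounded (Set.univ : Set X) := by
  by_contra hX
  obtain ⟨ε, hε, x, hx⟩ := exists_seq_le_dist_of_not_totallyBounded hX
  have hx' : ∀ {m n}, dist (x m) (x n) < ε → m = n := fun {m n} hmn => by
    by_contra hne
    exact (hx m n hne).not_gt hmn
  have hnear : ∀ n : ℕ, ∃ y, 0 < dist (x n) y ∧ dist (x n) y ≤ min (ε / 4) (1 / (n + 1 : ℝ)) := by
    intro n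
    refine hchain.exists_dist_le (z := x (n + 1)) ?_ (lt_min (by positivity) (by positivity))
    exact dist_pos.1 (hε.trans_le (hx n (n + 1) (by omega)))
  choose y hy_pos hy_le using hnear
  have hyε : ∀ n, dist (x n) (y n) ≤ ε / 4 := fun n => (hy_le n).trans (min_le_left _ _)
  let O : ℕ → Set X := fun n => ball (x n) (dist (x n) (y n))
  have hmem : ∀ {m n}, x m ∈ O n → m = n := fun {m n} hm =>
    hx' ((mem_ball.1 hm).trans_le (by linarith [hyε n]))
  have hself : ∀ n, x n ∈ O n := fun n => mem_ball_self (hy_pos n)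
  have hinj : Function.Injective O := fun m n hmn => hmem (hmn ▸ hself m)
  have hclosed : IsClosed (range x) := by
    refine Metric.isClosed_of_pairwise_le_dist hε ?_
    rintro _ ⟨m, rfl⟩ _ ⟨n, rfl⟩ hne
    exact hx m n fun hmn => hne (hmn ▸ rfl)
  obtain ⟨α, hα, hleb⟩ := h (insert (range x)ᶜ (range O)) ((countable_range O).insert _)
    ((infinite_range_of_injective hinj).mono (subset_insert _ _))
    (by
      rintro _ (rfl | ⟨n, rfl⟩)
      · exact hclosed.isOpen_compl
      · exact isOpen_ball)
    (by
      refine eq_univ_of_forall fun z => ?_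
      by_cases hz : z ∈ range x
      · obtain ⟨n, rfl⟩ := hz
        exact ⟨O n, Or.inr ⟨n, rfl⟩, hself n⟩
      · exact ⟨_, Or.inl rfl, hz⟩)
    (by
      intro z
      refine ⟨ball z (ε / 4), ball_mem_nhds z (by positivity), ?_⟩
      have hmeet : {V ∈ range O | (V ∩ ball z (ε / 4)).Nonempty}.Subsingleton := by
        rintro _ ⟨⟨m, rfl⟩, u, hu, huz⟩ _ ⟨⟨n, rfl⟩, v, hv, hvz⟩
        rw [mem_ball] at hu huz hv hvz
        refine congrArg O (hx' ?_)
        have h1 := dist_triangle_left (x m) z u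
        have h2 := dist_triangle_left (x n) z v
        have h3 := dist_triangle_right (x m) (x n) z
        linarith [hyε m, hyε n]
      refine (hmeet.finite.insert (range x)ᶜ).subset ?_
      rintro V ⟨rfl | hV, hVz⟩
      · exact Or.inl rfl
      · exact Or.inr ⟨hV, hVz⟩)
  obtain ⟨n, hn⟩ := exists_nat_one_div_lt hα
  have hdiam : Metric.ediam {x n, y n} < ENNReal.ofReal α := by
    rw [Metric.ediam_pair, edist_dist]
    exact (ENNReal.ofReal_lt_ofReal_iff hα).2 (((hy_le n).trans (min_le_right _ _)).trans_lt hn)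
  obtain ⟨V, hV, hVn⟩ := hleb {x n, y n} (subset_univ _) hdiam
  have hxV : x n ∈ V := hVn (by simp)
  have hyV : y n ∈ V := hVn (by simp)
  rcases hV with rfl | ⟨m, rfl⟩
  · exact hxV ⟨n, rfl⟩
  · obtain rfl := hmem hxV
    exact (mem_ball'.1 hyV).false
end

section
/- A chainable metric space X is compact if and only if X is uniformly locally compact and uniformly chainable. -/
open Metric Set

lemma IsEpsChain.of_dist_le {X : Type*} [MetricSpace X] {ε : ℝ} {x y : X}
    (h : dist x y ≤ ε) : IsEpsChain ε 1 (fun i => if i = 0 then x else y) x y := by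
  refine ⟨by simp, by simp, fun i hi => ?_⟩
  obtain rfl : i = 0 := by omega
  simpa using h

lemma IsEpsChain.trans {X : Type*} [MetricSpace X] {ε : ℝ} {m n : ℕ} {a b : ℕ → X} {x y z : X}
    (ha : IsEpsChain ε m a x y) (hb : IsEpsChain ε n b y z) :
    IsEpsChain ε (m + n) (fun i => if i < m then a i else b (i - m)) x z := by
  obtain ⟨ha₀, ham, ha⟩ := ha
  obtain ⟨hb₀, hbn, hb⟩ := hb
  refine ⟨?_, by simp [hbn], fun i hi => ?_⟩
  · rcases Nat.eq_zero_or_pos m with rfl | hm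
    · simp [hb₀, ← ha₀, ham]
    · simp [hm, ha₀]
  · rcases lt_trichotomy (i + 1) m with h | h | h
    · simpa [h, show i < m by omega] using ha i (by omega)
    · subst h
      simpa [hb₀, ham] using ha i (by omega)
    · have hsub : i + 1 - m = i - m + 1 := by omega
      simpa [show ¬ i + 1 < m by omega, show ¬ i < m by omega, hsub] using hb (i - m) (by omega)

lemma IsEpsChain.extend {X : Type*} [MetricSpace X] {ε : ℝ} (hε : 0 ≤ ε) {m n : ℕ} (hmn : m ≤ n)
    {a : ℕ → X} {x y : X} (ha : IsEpsChain ε m a x y) : ∃ b, IsEpsChain ε n b x y := by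
  have hconst : IsEpsChain ε (n - m) (fun _ => y) y y := ⟨rfl, rfl, fun _ _ => by simpa using hε⟩
  have h := ha.trans hconst
  rw [Nat.add_sub_cancel' hmn] at h
  exact ⟨_, h⟩

lemma Chainable.uniformlyChainable {X : Type*} [MetricSpace X] [CompactSpace X]
    (hchain : Chainable X) : UniformlyChainable X := by
  intro ε hε
  obtain ⟨t, -, ht, hcover⟩ :=
    finite_cover_balls_of_compact (isCompact_univ : IsCompact (univ : Set X)) hε
  have hnear (x : X) : ∃ p ∈ t, dist x p ≤ ε := by
    obtain ⟨p, hp, hxp⟩ := mem_iUnion₂.1 (hcover (mem_univ x))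
    exact ⟨p, hp, (mem_ball.1 hxp).le⟩
  choose len chain hlen using hchain ε hε
  obtain ⟨N, hN⟩ := ((ht.prod ht).image fun p => len p.1 p.2).bddAbove
  refine ⟨1 + N + 1, fun x y => ?_⟩
  obtain ⟨p, hp, hxp⟩ := hnear x
  obtain ⟨q, hq, hyq⟩ := hnear y
  obtain ⟨b, hb⟩ := (hlen p q).extend hε.le (hN (mem_image_of_mem _ (mk_mem_prod hp hq)))
  rw [dist_comm] at hyq
  exact ⟨_, ((IsEpsChain.of_dist_le hxp).trans hb).trans (IsEpsChain.of_dist_le hyq)⟩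

lemma IsCompact.exists_isCompact_superset_of_dist_le_half {X : Type*} [MetricSpace X] {ε : ℝ}
    (hε : 0 < ε) (hball : ∀ x : X, IsCompact (closedBall x ε)) {K : Set X} (hK : IsCompact K) :
    ∃ L, IsCompact L ∧ ∀ y ∈ K, ∀ z, dist y z ≤ ε / 2 → z ∈ L := by
  obtain ⟨t, -, ht, hcover⟩ := finite_cover_balls_of_compact hK (half_pos hε)
  refine ⟨⋃ p ∈ t, closedBall p ε, ht.isCompact_biUnion fun p _ => hball p, fun y hy z hyz => ?_⟩
  obtain ⟨p, hp, hyp⟩ := mem_iUnion₂.1 (hcover hy)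
  refine mem_iUnion₂.2 ⟨p, hp, mem_closedBall.2 ?_⟩
  rw [mem_ball] at hyp
  linarith [dist_triangle z y p, dist_comm z y]

lemma exists_isCompact_of_isEpsChain_half {X : Type*} [MetricSpace X] {ε : ℝ} (hε : 0 < ε)
    (hball : ∀ x : X, IsCompact (closedBall x ε)) (x : X) (n : ℕ) :
    ∃ K, IsCompact K ∧ ∀ y a, IsEpsChain (ε / 2) n a x y → y ∈ K := by
  induction n with
  | zero =>
    refine ⟨{x}, isCompact_singleton, ?_⟩
    rintro y a ⟨h₀, hy, -⟩
    exact hy.symm.trans h₀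
  | succ n ih =>
    obtain ⟨K, hK, hmem⟩ := ih
    obtain ⟨L, hL, hKL⟩ := hK.exists_isCompact_superset_of_dist_le_half hε hball
    refine ⟨L, hL, ?_⟩
    rintro y a ⟨h₀, rfl, ha⟩
    exact hKL (a n) (hmem _ a ⟨h₀, rfl, fun i hi => ha i (by omega)⟩) _ (ha n (by omega))

lemma UniformlyLocallyCompact.compactSpace {X : Type*} [MetricSpace X]
    (hlc : UniformlyLocallyCompact X) (hchain : UniformlyChainable X) : CompactSpace X := by
  rcases isEmpty_or_nonempty X with _ | ⟨⟨x⟩⟩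
  · infer_instance
  obtain ⟨ε, hε, hball⟩ := hlc
  obtain ⟨n, hn⟩ := hchain (ε / 2) (half_pos hε)
  obtain ⟨K, hK, hmem⟩ := exists_isCompact_of_isEpsChain_half hε hball x n
  have hKuniv : K = univ := eq_univ_of_forall fun y => (hn x y).elim fun a ha => hmem y a ha
  exact ⟨hKuniv ▸ hK⟩

/-- A chainable metric space is compact if and only if it is uniformly
locally compact and uniformly chainable. -/
theorem statement_17 {X : Type*} [MetricSpace X] (hchain : Chainable X) :
    CompactSpace X ↔ UniformlyLocallyCompact X ∧ UniformlyChainable X := by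
  exact ⟨fun _ => ⟨⟨1, one_pos, fun x => isClosed_closedBall.isCompact⟩,
    hchain.uniformlyChainable⟩, fun h => h.1.compactSpace h.2⟩
end
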